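/- Let n ≥ 1, let B̃ be a real n×n matrix, let b_s, V_0 ∈ ℝ^n have all entries strictly positive, and let h ∈ ℝ^n. If the set P contains at least two distinct points, then no point of P is isolated in P: for every r ∈ P and every open set B ⊆ ℝ^n containing r, the intersection B ∩ P contains a point distinct from r. -/

import Mathlib

/-- The region of a branch of a hyperbola is convex: its defining product bound is preserved by
convex combinations. -/
theorem le_mul_of_convexComb {x y u v a b c : ℝ} (hx : 0 < x) (hy : 0 < y) (hu : 0 < u)
    (hv : 0 < v) (ha : 0 ≤ a) (hb : 0 ≤ b) (hab : a + b = 1) (hc : 0 ≤ c)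
    (hxy : c ≤ x * y) (huv : c ≤ u * v) : c ≤ (a * x + b * u) * (a * y + b * v) := by
  have hmul : c * c ≤ (x * y) * (u * v) := mul_le_mul hxy huv hc (by positivity)
  have hcross : 2 * c ≤ x * v + u * y := by
    apply le_of_sq_le_sq _ (by positivity)
    nlinarith [sq_nonneg (x * v - u * y)]
  calc c = a ^ 2 * c + a * b * (2 * c) + b ^ 2 * c := by
        linear_combination (-(a + b) * c - c) * hab
    _ ≤ a ^ 2 * (x * y) + a * b * (x * v + u * y) + b ^ 2 * (u * v) := by gcongr
    _ = _ := by ring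

/-- The voltages `V` that solve the network equations for some admissible `r`, described without
reference to `r`. -/
def admissibleVoltages {n : ℕ} (Btil : Matrix (Fin n) (Fin n) ℝ) (bs V0 h : Fin n → ℝ) :
    Set (Fin n → ℝ) :=
  {V | ∀ i, 0 < V i ∧ 0 < h i - Btil.mulVec V i ∧
    bs i * V0 i ^ 2 ≤ V i * (h i - Btil.mulVec V i)}

theorem convex_admissibleVoltages {n : ℕ} (Btil : Matrix (Fin n) (Fin n) ℝ)
    (bs V0 h : Fin n → ℝ) (hbs : ∀ i, 0 < bs i) :
    Convex ℝ (admissibleVoltages Btil bs V0 h) := by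
  intro V hV W hW a b ha hb hab i
  obtain ⟨hV1, hV2, hV3⟩ := hV i
  obtain ⟨hW1, hW2, hW3⟩ := hW i
  have hg : h i - Btil.mulVec (a • V + b • W) i =
      a * (h i - Btil.mulVec V i) + b * (h i - Btil.mulVec W i) := by
    simp only [Matrix.mulVec_add, Matrix.mulVec_smul, Pi.add_apply, Pi.smul_apply, smul_eq_mul]
    linear_combination (-h i) * hab
  have hpos {x y : ℝ} (hx : 0 < x) (hy : 0 < y) : 0 < a * x + b * y :=
    convex_Ioi (0 : ℝ) hx hy ha hb hab
  rw [hg]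
  simp only [Pi.add_apply, Pi.smul_apply, smul_eq_mul]
  have := hbs i
  exact ⟨hpos hV1 hW1, hpos hV2 hW2,
    le_mul_of_convexComb hV1 hV2 hW1 hW2 ha hb hab (by positivity) hV3 hW3⟩

theorem image_admissibleVoltages {n : ℕ} (Btil : Matrix (Fin n) (Fin n) ℝ)
    (bs V0 h : Fin n → ℝ) (hbs : ∀ i, 0 < bs i) (hV0 : ∀ i, 0 < V0 i) :
    (fun V i => √(bs i * V i / (h i - Btil.mulVec V i))) '' admissibleVoltages Btil bs V0 h =
      {r : Fin n → ℝ | (∀ i, 0 < r i) ∧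
        ∃ V : Fin n → ℝ,
          (Btil + Matrix.diagonal fun i => bs i / (r i) ^ 2).mulVec V = h ∧
          ∀ i, r i * V0 i ≤ V i} := by
  ext r
  constructor
  · rintro ⟨V, hV, rfl⟩
    refine ⟨fun i => ?_, V, ?_, fun i => ?_⟩
    · obtain ⟨h1, h2, -⟩ := hV i
      have := hbs i
      exact Real.sqrt_pos.2 (by positivity)
    · ext i
      obtain ⟨h1, h2, -⟩ := hV i
      have := hbs i
      rw [Matrix.add_mulVec, Pi.add_apply, Matrix.mulVec_diagonal, Real.sq_sqrt (by positivity)]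
      field_simp
      ring
    · obtain ⟨h1, h2, h3⟩ := hV i
      have := hbs i
      have := hV0 i
      apply le_of_sq_le_sq _ h1.le
      rw [mul_pow, Real.sq_sqrt (by positivity), div_mul_eq_mul_div, div_le_iff₀ h2]
      nlinarith [mul_le_mul_of_nonneg_left h3 h1.le]
  · rintro ⟨hr, V, hV, hle⟩
    have hg (i) : h i - Btil.mulVec V i = bs i / r i ^ 2 * V i := by
      rw [← hV, Matrix.add_mulVec, Pi.add_apply, Matrix.mulVec_diagonal]
      ring
    have hVpos (i) : 0 < V i := (mul_pos (hr i) (hV0 i)).trans_le (hle i)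
    refine ⟨V, fun i => ?_, ?_⟩
    · have h1 := hVpos i
      have h2 := hr i
      have h3 := hbs i
      have h4 := hV0 i
      rw [hg]
      refine ⟨h1, by positivity, ?_⟩
      have hsq : (r i * V0 i) ^ 2 ≤ V i ^ 2 := by gcongr; exact hle i
      calc bs i * V0 i ^ 2 = bs i / r i ^ 2 * (r i * V0 i) ^ 2 := by field_simp
        _ ≤ bs i / r i ^ 2 * V i ^ 2 := by gcongr
        _ = _ := by ring
    · ext i
      have h1 := hVpos i
      have h2 := hr i
      have h3 := hbs i
      simp only [hg]
      rw [show bs i * V i / (bs i / r i ^ 2 * V i) = r i ^ 2 by field_simp, Real.sqrt_sq h2.le]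

theorem continuousOn_admissibleVoltages {n : ℕ} (Btil : Matrix (Fin n) (Fin n) ℝ)
    (bs V0 h : Fin n → ℝ) :
    ContinuousOn (fun V i => √(bs i * V i / (h i - Btil.mulVec V i)))
      (admissibleVoltages Btil bs V0 h) := by
  have hB : Continuous fun V => Btil.mulVec V := continuous_const.matrix_mulVec continuous_id
  refine continuousOn_pi.2 fun i => Real.continuous_sqrt.comp_continuousOn ?_
  exact ContinuousOn.div (by fun_prop) (by fun_prop) fun V hV => (hV i).2.1.ne'

/-- Lemma 4 (`thm:connectd`): if `P` contains at least two distinct points, then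
no point of `P` is isolated in `P`. -/
theorem P_no_isolated_point
    (n : ℕ) (hn : 1 ≤ n)
    (Btil : Matrix (Fin n) (Fin n) ℝ) (bs V0 h : Fin n → ℝ)
    (hbs : ∀ i, 0 < bs i) (hV0 : ∀ i, 0 < V0 i)
    (P : Set (Fin n → ℝ))
    (hP : P = {r : Fin n → ℝ | (∀ i, 0 < r i) ∧
      ∃ V : Fin n → ℝ,
        (Btil + Matrix.diagonal fun i => bs i / (r i) ^ 2).mulVec V = h ∧
        ∀ i, r i * V0 i ≤ V i})
    (htwo : ∃ s ∈ P, ∃ t ∈ P, s ≠ t) :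
    ∀ r ∈ P, ∀ B : Set (Fin n → ℝ), IsOpen B → r ∈ B →
      ∃ x ∈ B ∩ P, x ≠ r := by
  have hconn : IsPreconnected P := by
    rw [hP, ← image_admissibleVoltages Btil bs V0 h hbs hV0]
    exact (convex_admissibleVoltages Btil bs V0 h hbs).isPreconnected.image _
      (continuousOn_admissibleVoltages Btil bs V0 h)
  intro r hr B hB hrB
  exact accPt_iff_nhds.1 (hconn.preperfect_of_nontrivial htwo r hr) B (hB.mem_nhds hrB)
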